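/- arXiv:1706.07739 — 8 statements merged into one kernel-verified Lean document; each statement's English description precedes it below -/
import Mathlib

section
/- For every live graph X on a finite node set V, the influence spread function σ^X : Finset V → ℝ, which maps a seed set S to the number of nodes of V reachable from S in X, is nonnegative, monotone increasing, and submodular. -/
/-- A node `v` is reachable from the seed set `S` in the live graph `X`
(reflexive-transitive closure of the edge relation). -/
def reach {V : Type*} (X : V → V → Prop) (S : Finset V) (v : V) : Prop :=
  ∃ u ∈ S, Relation.ReflTransGen X u v

/-- `σ^X(S)`: the number of nodes reachable from the seed set `S` in the live graph `X`. -/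
noncomputable def sigma' {V : Type*} (X : V → V → Prop) (S : Finset V) : ℝ :=
  (Set.ncard {v | reach X S v} : ℝ)

theorem setOf_reach_mono {V : Type*} (X : V → V → Prop) {S T : Finset V} (h : S ⊆ T) :
    {v | reach X S v} ⊆ {v | reach X T v} :=
  fun _ ⟨u, hu, huv⟩ => ⟨u, h hu, huv⟩

theorem setOf_reach_union {V : Type*} [DecidableEq V] (X : V → V → Prop) (S T : Finset V) :
    {v | reach X (S ∪ T) v} = {v | reach X T v} ∪ {v | reach X S v} := by
  ext v
  simp only [reach, Finset.mem_union, Set.mem_union, Set.mem_ofPred_eq, or_and_right, exists_or]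
  exact or_comm

/-- The marginal gain of adding the seeds `T` to `S` counts the nodes reachable from `T`
but not from `S`. -/
theorem sigma'_union_sub {V : Type*} [Finite V] [DecidableEq V] (X : V → V → Prop)
    (S T : Finset V) :
    sigma' X (S ∪ T) - sigma' X S = (({v | reach X T v} \ {v | reach X S v}).ncard : ℝ) := by
  rw [sigma', sigma', setOf_reach_union, ← Set.ncard_sdiff_add_ncard _ _ (Set.toFinite _)
    (Set.toFinite _)]
  push_cast
  ring

/-- For every live graph `X` on a finite node set `V`, the influence spread function
`σ^X` is nonnegative, monotone increasing, and submodular. -/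
theorem sigma_nonneg_monotone_submodular {V : Type*} [Fintype V] [DecidableEq V]
    (X : V → V → Prop) :
    (∀ S : Finset V, 0 ≤ sigma' X S) ∧
    (∀ S T : Finset V, S ⊆ T → sigma' X S ≤ sigma' X T) ∧
    (∀ S T : Finset V, S ⊆ T → ∀ i ∉ T,
      sigma' X (T ∪ {i}) - sigma' X T ≤ sigma' X (S ∪ {i}) - sigma' X S) := by
  refine ⟨fun S => Nat.cast_nonneg _, fun S T h => ?_, fun S T h i _ => ?_⟩
  · exact Nat.cast_le.mpr (Set.ncard_le_ncard (setOf_reach_mono X h) (Set.toFinite _))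
  · rw [sigma'_union_sub, sigma'_union_sub]
    exact Nat.cast_le.mpr (Set.ncard_le_ncard
      (Set.sdiff_subset_sdiff_right (setOf_reach_mono X h)) (Set.toFinite _))
end

section
/- Greedy hill-climbing achieves a (1 − 1/e)-approximation for maximizing a nonnegative, monotone increasing, submodular set function under a cardinality constraint: if F : Finset V → ℝ is nonnegative, monotone increasing, and submodular on a finite set V, k ≤ |V|, and G_k is the greedy set of size k, then F(G_k) ≥ (1 − 1/e) · max_{S ⊆ V, |S| ≤ k} F(S), where e is Euler's number. -/
/-- If every single-element marginal of a submodular function over `A` is at most `c ≥ 0`, then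
adjoining a set `S` to `A` increases the function by at most `|S| * c`. -/
theorem submodular_union_le_add_card_mul {V : Type*} [DecidableEq V] {F : Finset V → ℝ}
    (hsubmod : ∀ S T : Finset V, S ⊆ T → ∀ i ∉ T,
      F (T ∪ {i}) - F T ≤ F (S ∪ {i}) - F S)
    {A : Finset V} {c : ℝ} (hc : 0 ≤ c) (hA : ∀ i ∉ A, F (A ∪ {i}) - F A ≤ c)
    (S : Finset V) : F (A ∪ S) ≤ F A + S.card * c := by
  induction S using Finset.induction_on with
  | empty => simp
  | insert i S hi ih =>
    rw [Finset.card_insert_of_notMem hi]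
    push_cast
    by_cases h : i ∈ A ∪ S
    · rw [Finset.union_insert, Finset.insert_eq_of_mem h]
      linarith
    · have hmarg := hsubmod A (A ∪ S) Finset.subset_union_left i h
      have hiA := hA i fun hmem => h (Finset.mem_union_left S hmem)
      rw [show A ∪ insert i S = A ∪ S ∪ {i} by
        rw [Finset.union_insert, Finset.insert_eq, Finset.union_comm]]
      linarith


/-- Greedy hill-climbing achieves a `(1 - 1/e)`-approximation for maximizing a
nonnegative, monotone increasing, submodular set function under a cardinality
constraint: if `G : ℕ → Finset V` is a greedy sequence (`G 0 = ∅`, and `G (j+1)`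
adds to `G j` an element of `V \ G j` maximizing the function value), then
`F (G k) ≥ (1 - 1/e) · F S` for every `S` with `|S| ≤ k`. -/
theorem greedy_one_sub_inv_e_approx {V : Type*} [Fintype V] [DecidableEq V]
    (F : Finset V → ℝ)
    (hnonneg : ∀ S : Finset V, 0 ≤ F S)
    (hmono : ∀ S T : Finset V, S ⊆ T → F S ≤ F T)
    (hsubmod : ∀ S T : Finset V, S ⊆ T → ∀ i ∉ T,
      F (T ∪ {i}) - F T ≤ F (S ∪ {i}) - F S)
    (k : ℕ) (hk : k ≤ Fintype.card V)
    (G : ℕ → Finset V) (hG0 : G 0 = ∅)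
    (hGstep : ∀ j < k, ∃ i ∈ Finset.univ \ G j,
      (∀ i' ∈ Finset.univ \ G j, F (G j ∪ {i'}) ≤ F (G j ∪ {i})) ∧
      G (j + 1) = G j ∪ {i}) :
    ∀ S : Finset V, S.card ≤ k → (1 - (Real.exp 1)⁻¹) * F S ≤ F (G k) := by
  intro S hS
  have hFS := hnonneg S
  rcases Nat.eq_zero_or_pos k with rfl | hkpos
  · obtain rfl : S = ∅ := Finset.card_eq_zero.mp (Nat.le_zero.mp hS)
    rw [hG0]
    nlinarith [inv_pos.mpr (Real.exp_pos 1)]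
  have hk0 : (0 : ℝ) < k := Nat.cast_pos.mpr hkpos
  have hstep : ∀ j < k, F S - F (G j) ≤ k * (F (G (j + 1)) - F (G j)) := by
    intro j hj
    obtain ⟨i, -, hmax, hG⟩ := hGstep j hj
    have hc : 0 ≤ F (G (j + 1)) - F (G j) := by
      rw [hG]
      exact sub_nonneg.mpr (hmono _ _ Finset.subset_union_left)
    have hunion := submodular_union_le_add_card_mul hsubmod hc (A := G j) (fun i' hi' => by
      rw [hG]
      exact sub_le_sub_right (hmax i' (by simpa using hi')) _) S
    have hle := hmono S (G j ∪ S) Finset.subset_union_right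
    have hcard := mul_le_mul_of_nonneg_right (Nat.cast_le (α := ℝ).mpr hS) hc
    linarith
  have hratio : 0 ≤ 1 - 1 / (k : ℝ) := by
    rw [sub_nonneg, div_le_one hk0]
    exact_mod_cast hkpos
  have hgap : ∀ j ≤ k, F S - F (G j) ≤ (1 - 1 / (k : ℝ)) ^ j * F S := by
    intro j
    induction j with
    | zero =>
      intro _
      simpa using hnonneg (G 0)
    | succ j ih =>
      intro hj
      have hcontract : F S - F (G (j + 1)) ≤ (1 - 1 / (k : ℝ)) * (F S - F (G j)) := by
        have hdiv := (div_le_iff₀' hk0).mpr (hstep j hj)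
        linear_combination hdiv
      calc F S - F (G (j + 1)) ≤ (1 - 1 / (k : ℝ)) * (F S - F (G j)) := hcontract
        _ ≤ (1 - 1 / (k : ℝ)) * ((1 - 1 / (k : ℝ)) ^ j * F S) :=
          mul_le_mul_of_nonneg_left (ih (Nat.le_of_succ_le hj)) hratio
        _ = (1 - 1 / (k : ℝ)) ^ (j + 1) * F S := by ring
  have hexp : (1 - 1 / (k : ℝ)) ^ k ≤ (Real.exp 1)⁻¹ := by
    rw [← Real.exp_neg]
    exact Real.one_sub_div_pow_le_exp_neg (by exact_mod_cast hkpos)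
  linarith [hgap k le_rfl, mul_le_mul_of_nonneg_right hexp hFS]
end

section
/- The two-phase influence objective is subadditive: for any fixed second-phase budget k₂ and any fixed partition 𝒫 of the set 𝒳 of live graphs, F_𝒫(S₁ ∪ T₁) ≤ F_𝒫(S₁) + F_𝒫(T₁) for all S₁, T₁ ⊆ V. -/
/-- The collection of candidate second-phase seed sets (subsets of `V` of size at most
`k₂`); it is nonempty since it contains `∅`. -/
noncomputable def candidates (V : Type*) [Fintype V] [DecidableEq V] (k₂ : ℕ) :
    Finset (Finset V) :=
  (Finset.univ : Finset V).powerset.filter fun S₂ => S₂.card ≤ k₂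

theorem candidates_nonempty (V : Type*) [Fintype V] [DecidableEq V] (k₂ : ℕ) :
    (candidates V k₂).Nonempty :=
  ⟨∅, by simp [candidates]⟩

/-- The two-phase influence objective: the live graphs form a finite family indexed by
`ι`, with probability weights `p`, `k₂` is the second-phase budget, and `P` is a
partition of the family of live graphs into blocks (possible partial observations).
`F_P(S₁) = Σ_{B ∈ P} max_{S₂ ⊆ V, |S₂| ≤ k₂} Σ_{X ∈ B} p(X) σ^X(S₁ ∪ S₂)`. -/
noncomputable def twoPhase {V : Type*} [Fintype V] [DecidableEq V]
    {ι : Type*} [Fintype ι] [DecidableEq ι]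
    (X : ι → V → V → Prop) (p : ι → ℝ) (k₂ : ℕ)
    (P : Finpartition (Finset.univ : Finset ι)) (S₁ : Finset V) : ℝ :=
  ∑ B ∈ P.parts,
    (candidates V k₂).sup' (candidates_nonempty V k₂)
      fun S₂ => ∑ i ∈ B, p i * sigma' (X i) (S₁ ∪ S₂)

theorem reach_union {V : Type*} [DecidableEq V] (X : V → V → Prop) (S T : Finset V) (v : V) :
    reach X (S ∪ T) v ↔ reach X S v ∨ reach X T v := by
  simp only [reach, Finset.mem_union, or_and_right, exists_or]

theorem sigma'_union_le {V : Type*} [DecidableEq V] (X : V → V → Prop) (S T : Finset V) :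
    sigma' X (S ∪ T) ≤ sigma' X S + sigma' X T := by
  simp only [sigma', reach_union]
  exact_mod_cast Set.ncard_union_le {v | reach X S v} {v | reach X T v}

/-- The two-phase influence objective is subadditive: for any fixed second-phase budget
`k₂` and any fixed partition `P` of the set of live graphs,
`F_P(S₁ ∪ T₁) ≤ F_P(S₁) + F_P(T₁)`. -/
theorem twoPhase_subadditive {V : Type*} [Fintype V] [DecidableEq V]
    {ι : Type*} [Fintype ι] [DecidableEq ι]
    (X : ι → V → V → Prop) (p : ι → ℝ)
    (hp : ∀ i, 0 ≤ p i) (hp1 : ∑ i, p i = 1)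
    (k₂ : ℕ) (P : Finpartition (Finset.univ : Finset ι)) :
    ∀ S₁ T₁ : Finset V,
      twoPhase X p k₂ P (S₁ ∪ T₁) ≤ twoPhase X p k₂ P S₁ + twoPhase X p k₂ P T₁ := by
  intro S₁ T₁
  rw [twoPhase, twoPhase, twoPhase, ← Finset.sum_add_distrib]
  refine Finset.sum_le_sum fun B _ => Finset.sup'_le _ _ fun S₂ hS₂ => ?_
  calc ∑ i ∈ B, p i * sigma' (X i) (S₁ ∪ T₁ ∪ S₂)
      ≤ ∑ i ∈ B, (p i * sigma' (X i) (S₁ ∪ S₂) + p i * sigma' (X i) (T₁ ∪ S₂)) := by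
        refine Finset.sum_le_sum fun i _ => ?_
        rw [← mul_add, Finset.union_union_distrib_right]
        exact mul_le_mul_of_nonneg_left (sigma'_union_le _ _ _) (hp i)
    _ = ∑ i ∈ B, p i * sigma' (X i) (S₁ ∪ S₂) + ∑ i ∈ B, p i * sigma' (X i) (T₁ ∪ S₂) :=
        Finset.sum_add_distrib
    _ ≤ _ := add_le_add
        (Finset.le_sup' (fun S₂ => ∑ i ∈ B, p i * sigma' (X i) (S₁ ∪ S₂)) hS₂)
        (Finset.le_sup' (fun S₂ => ∑ i ∈ B, p i * sigma' (X i) (T₁ ∪ S₂)) hS₂)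
end

section
/- The two-phase influence objective is in general neither submodular nor supermodular: there exist a finite node set V, a finite family 𝒳 of live graphs on V with probability weights p, a budget k₂, a partition 𝒫 of 𝒳, sets S ⊆ T ⊆ V, and i ∈ V \ T such that F_𝒫(S ∪ {i}) − F_𝒫(S) < F_𝒫(T ∪ {i}) − F_𝒫(T); and there also exist such data (a possibly different instance and sets) for which F_𝒫(S ∪ {i}) − F_𝒫(S) > F_𝒫(T ∪ {i}) − F_𝒫(T). -/
theorem sigma'_eq_card {V : Type*} [Fintype V] [DecidableEq V] (X : V → V → Prop)
    [DecidableRel X] [IsTrans V X] (S : Finset V) :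
    sigma' X S = ((Finset.univ.filter fun v => ∃ u ∈ S, v = u ∨ X u v).card : ℝ) := by
  have h : {v | reach X S v} = ↑(Finset.univ.filter fun v => ∃ u ∈ S, v = u ∨ X u v) := by
    ext v
    simp [reach, Relation.reflTransGen_iff_eq_or_transGen, Relation.transGen_eq_self]
  rw [sigma', h, Set.ncard_coe_finset]

/-- For a single transitive live graph the two-phase objective is a maximum of cardinalities. -/
theorem twoPhase_single_eq {V : Type*} [Fintype V] [DecidableEq V] (X : V → V → Prop)
    [DecidableRel X] [IsTrans V X] (k₂ : ℕ) (S : Finset V) :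
    twoPhase (fun _ : Fin 1 => X) (fun _ => 1) k₂
        (Finpartition.indiscrete (Finset.univ_nonempty.ne_empty)) S =
      (((Finset.univ.powerset.filter fun S₂ : Finset V => S₂.card ≤ k₂).sup fun S₂ =>
        (Finset.univ.filter fun v => ∃ u ∈ S ∪ S₂, v = u ∨ X u v).card : ℕ) : ℝ) := by
  simp only [twoPhase, Finpartition.indiscrete_parts, Finset.sum_singleton, Finset.univ_unique,
    one_mul, sigma'_eq_card]
  change _ = (((candidates V k₂).sup _ : ℕ) : ℝ)
  rw [← Finset.sup'_eq_sup (candidates_nonempty V k₂)]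
  exact (Finset.apply_sup'_eq_sup'_comp (candidates_nonempty V k₂) (Nat.cast : ℕ → ℝ)
    fun _ _ => Nat.cast_max _ _).symm

/-- The two-phase influence objective is in general neither submodular nor supermodular:
there is an instance (a finite node set, a finite weighted family of live graphs, a
budget, and a partition) together with sets `S ⊆ T` and `i ∉ T` violating the
submodularity inequality, and another such instance violating the supermodularity
inequality. -/
theorem twoPhase_not_submodular_not_supermodular :
    (∃ (n m : ℕ) (X : Fin m → Fin n → Fin n → Prop) (p : Fin m → ℝ) (k₂ : ℕ)
       (P : Finpartition (Finset.univ : Finset (Fin m)))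
       (S T : Finset (Fin n)) (i : Fin n),
       (∀ j, 0 ≤ p j) ∧ (∑ j, p j = 1) ∧ S ⊆ T ∧ i ∉ T ∧
       twoPhase X p k₂ P (S ∪ {i}) - twoPhase X p k₂ P S <
         twoPhase X p k₂ P (T ∪ {i}) - twoPhase X p k₂ P T) ∧
    (∃ (n m : ℕ) (X : Fin m → Fin n → Fin n → Prop) (p : Fin m → ℝ) (k₂ : ℕ)
       (P : Finpartition (Finset.univ : Finset (Fin m)))
       (S T : Finset (Fin n)) (i : Fin n),
       (∀ j, 0 ≤ p j) ∧ (∑ j, p j = 1) ∧ S ⊆ T ∧ i ∉ T ∧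
       twoPhase X p k₂ P (T ∪ {i}) - twoPhase X p k₂ P T <
         twoPhase X p k₂ P (S ∪ {i}) - twoPhase X p k₂ P S) := by
  constructor
  · let X : Fin 5 → Fin 5 → Prop := fun u v => (u = 2 ∧ v ≤ 1) ∨ (u = 3 ∧ v = 4)
    let : DecidableRel X := fun u v => inferInstanceAs (Decidable (_ ∨ _))
    have : IsTrans (Fin 5) X := ⟨by decide⟩
    refine ⟨5, 1, fun _ => X, fun _ => 1, 1,
      Finpartition.indiscrete Finset.univ_nonempty.ne_empty, ∅, {0}, 1,
      by simp, by simp, by simp, by simp, ?_⟩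
    simp only [twoPhase_single_eq]
    rw [sub_lt_sub_iff]
    exact_mod_cast (by decide +kernel)
  · let X : Fin 2 → Fin 2 → Prop := fun _ _ => True
    let : DecidableRel X := fun _ _ => inferInstanceAs (Decidable True)
    have : IsTrans (Fin 2) X := ⟨fun _ _ _ _ _ => trivial⟩
    refine ⟨2, 1, fun _ => X, fun _ => 1, 0,
      Finpartition.indiscrete Finset.univ_nonempty.ne_empty, ∅, {0}, 1,
      by simp, by simp, by simp, by simp, ?_⟩
    simp only [twoPhase_single_eq]
    rw [sub_lt_sub_iff]
    exact_mod_cast (by decide +kernel)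
end

section
/- The number of nodes influenced by an optimal two-phase influence maximization strategy is a non-decreasing function of the delay at which the second phase starts: for every first-phase seed set S₁ ⊆ V, every second-phase budget k₂, and all natural numbers d ≤ d', F_{Obs(S₁, d)}(S₁) ≤ F_{Obs(S₁, d')}(S₁). -/
/-- `reachIn X n u v` holds iff there is a directed path of length exactly `n`
from `u` to `v` in the live graph `X`. -/
def reachIn {V : Type*} (X : V → V → Prop) : ℕ → V → V → Prop
  | 0 => fun u v => u = v
  | n + 1 => fun u v => ∃ w, X u w ∧ reachIn X n w v

/-- `dist_X(S, v)`: the directed graph distance in the live graph `X` from the set `S`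
to the node `v` (minimum length of a directed path from a node of `S` to `v`, `0` if
`v ∈ S`, and `⊤` if `v` is not reachable from `S`). -/
noncomputable def edistFrom {V : Type*} (X : V → V → Prop) (S : Finset V) (v : V) : ℕ∞ :=
  ⨅ (n : ℕ) (_ : ∃ u ∈ S, reachIn X n u v), (n : ℕ∞)

open scoped Classical in
/-- `Obs(S₁, d)`: the observation partition of the family of live graphs at delay `d`,
whose blocks are the fibers of the map sending a live graph `X` to the `d`-truncated
distance function `v ↦ min (dist_X(S₁, v)) d`. -/
noncomputable def obsPartition {V : Type*} [Fintype V] {ι : Type*} [Fintype ι]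
    [DecidableEq ι] (X : ι → V → V → Prop) (S₁ : Finset V) (d : ℕ) :
    Finpartition (Finset.univ : Finset ι) :=
  Finpartition.ofSetoid
    (Setoid.ker fun i => fun v : V => min (edistFrom (X i) S₁ v) (d : ℕ∞))

/-- Refining the observation partition does not decrease the two-phase objective. -/
theorem twoPhase_le_of_refines {V : Type*} [Fintype V] [DecidableEq V]
    {ι : Type*} [Fintype ι] [DecidableEq ι]
    (X : ι → V → V → Prop) (p : ι → ℝ) (k₂ : ℕ) (S₁ : Finset V)
    {P Q : Finpartition (Finset.univ : Finset ι)} (hPQ : P ≤ Q) :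
    twoPhase X p k₂ Q S₁ ≤ twoPhase X p k₂ P S₁ := by
  have hsum (R : Finpartition (Finset.univ : Finset ι)) (f : ι → ℝ) :
      ∑ B ∈ R.parts, ∑ i ∈ B, f i = ∑ i, f i := by
    simpa only [R.biUnion_parts, id] using
      (Finset.sum_biUnion (f := f) R.supIndep.pairwiseDisjoint).symm
  choose S hS hmax using fun B : Finset ι =>
    Finset.exists_mem_eq_sup' (candidates_nonempty V k₂)
      fun S₂ => ∑ i ∈ B, p i * sigma' (X i) (S₁ ∪ S₂)
  calc twoPhase X p k₂ Q S₁
      = ∑ B ∈ Q.parts, ∑ i ∈ B, p i * sigma' (X i) (S₁ ∪ S (Q.part i)) := by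
        refine Finset.sum_congr rfl fun B hB => (hmax B).trans ?_
        refine Finset.sum_congr rfl fun i hi => ?_
        rw [Q.part_eq_of_mem hB hi]
    _ = ∑ A ∈ P.parts, ∑ i ∈ A, p i * sigma' (X i) (S₁ ∪ S (Q.part i)) := by
        rw [hsum, hsum]
    _ ≤ twoPhase X p k₂ P S₁ := by
        refine Finset.sum_le_sum fun A hA => ?_
        obtain ⟨B, hB, hAB⟩ := hPQ hA
        refine le_trans (le_of_eq ?_) (Finset.le_sup' _ (hS B))
        refine Finset.sum_congr rfl fun i hi => ?_
        rw [Q.part_eq_of_mem hB (hAB hi)]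

/-- A longer delay yields a finer observation partition. -/
theorem obsPartition_antitone {V : Type*} [Fintype V] {ι : Type*} [Fintype ι]
    [DecidableEq ι] (X : ι → V → V → Prop) (S₁ : Finset V) :
    Antitone (obsPartition X S₁) := by
  classical
  intro d d' hd A hA
  obtain ⟨i, hi⟩ := (obsPartition X S₁ d').nonempty_of_mem_parts hA
  refine ⟨(obsPartition X S₁ d).part i, by simp, fun j hj => ?_⟩
  rw [← (obsPartition X S₁ d').part_eq_of_mem hA hi] at hj
  simp only [obsPartition, Finpartition.mem_part_ofSetoid_iff_rel, Setoid.ker_def] at hj ⊢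
  funext v
  have hv := congrArg (min · (d : ℕ∞)) (congrFun hj v)
  have hd' : min (d' : ℕ∞) d = d := min_eq_right (by exact_mod_cast hd)
  simpa only [min_assoc, hd'] using hv

/-- The number of nodes influenced by an optimal two-phase strategy is a non-decreasing
function of the delay at which the second phase starts: for `d ≤ d'`,
`F_{Obs(S₁,d)}(S₁) ≤ F_{Obs(S₁,d')}(S₁)`. -/
theorem twoPhase_obs_mono_in_delay {V : Type*} [Fintype V] [DecidableEq V]
    {ι : Type*} [Fintype ι] [DecidableEq ι]
    (X : ι → V → V → Prop) (p : ι → ℝ)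
    (hp : ∀ i, 0 ≤ p i) (hp1 : ∑ i, p i = 1) :
    ∀ (S₁ : Finset V) (k₂ : ℕ) (d d' : ℕ), d ≤ d' →
      twoPhase X p k₂ (obsPartition X S₁ d) S₁ ≤
        twoPhase X p k₂ (obsPartition X S₁ d') S₁ := by
  intro S₁ k₂ d d' hd
  exact twoPhase_le_of_refines X p k₂ S₁ (obsPartition_antitone X S₁ hd)
end

section
/- The two-phase objective is maximized by waiting until the first-phase diffusion is complete: for every first-phase seed set S₁ ⊆ V, every second-phase budget k₂, every D ≥ |V|, and every d ∈ ℕ, F_{Obs(S₁, d)}(S₁) ≤ F_{Obs(S₁, D)}(S₁). -/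
theorem reachIn_succ_right {V : Type*} {X : V → V → Prop} {n : ℕ} {u v : V} :
    reachIn X (n + 1) u v ↔ ∃ w, reachIn X n u w ∧ X w v := by
  induction n generalizing u with
  | zero => simp [reachIn]
  | succ n ih =>
    rw [reachIn]
    simp only [ih]
    simp only [reachIn]
    constructor
    · rintro ⟨w, hw, x, hx, hxv⟩
      exact ⟨x, ⟨w, hw, hx⟩, hxv⟩
    · rintro ⟨x, ⟨w, hw, hx⟩, hxv⟩
      exact ⟨w, hw, x, hx, hxv⟩

theorem edistFrom_le {V : Type*} {X : V → V → Prop} {S : Finset V} {n : ℕ} {u v : V}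
    (hu : u ∈ S) (h : reachIn X n u v) : edistFrom X S v ≤ n :=
  iInf₂_le n ⟨u, hu, h⟩

theorem exists_reachIn_of_edistFrom_eq {V : Type*} {X : V → V → Prop} {S : Finset V} {n : ℕ}
    {v : V} (h : edistFrom X S v = n) : ∃ u ∈ S, reachIn X n u v := by
  have hlt : edistFrom X S v < ((n + 1 : ℕ) : ℕ∞) := by
    rw [h]
    exact_mod_cast Nat.lt_succ_self n
  unfold edistFrom at hlt
  simp only [iInf_lt_iff] at hlt
  obtain ⟨m, ⟨u, hu, hm⟩, hmn⟩ := hlt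
  have hnm : n ≤ m := by exact_mod_cast h ▸ edistFrom_le hu hm
  have hmn' : m < n + 1 := by exact_mod_cast hmn
  obtain rfl : m = n := by omega
  exact ⟨u, hu, hm⟩

/-- The predecessor of `v` on a shortest path is exactly one step closer. -/
theorem exists_edistFrom_eq_of_succ {V : Type*} {X : V → V → Prop} {S : Finset V} {n : ℕ}
    {v : V} (h : edistFrom X S v = (n + 1 : ℕ)) : ∃ w, edistFrom X S w = n := by
  obtain ⟨u, hu, hr⟩ := exists_reachIn_of_edistFrom_eq h
  obtain ⟨w, hw, hwv⟩ := reachIn_succ_right.1 hr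
  have hle := edistFrom_le hu hw
  obtain ⟨m, hm⟩ := ENat.ne_top_iff_exists.1 (ne_top_of_le_ne_top (ENat.natCast_ne_top n) hle)
  obtain ⟨u', hu', hr'⟩ := exists_reachIn_of_edistFrom_eq hm.symm
  have hge := edistFrom_le hu' (reachIn_succ_right.2 ⟨w, hr', hwv⟩)
  rw [h] at hge
  rw [← hm] at hle
  have h₁ : n + 1 ≤ m + 1 := by exact_mod_cast hge
  have h₂ : m ≤ n := by exact_mod_cast hle
  obtain rfl : m = n := by omega
  exact ⟨w, hm.symm⟩

theorem exists_edistFrom_eq_of_le {V : Type*} {X : V → V → Prop} {S : Finset V} {m n : ℕ}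
    (hmn : m ≤ n) (h : ∃ v, edistFrom X S v = n) : ∃ w, edistFrom X S w = m := by
  induction n, hmn using Nat.le_induction with
  | base => exact h
  | succ n _ ih =>
    obtain ⟨v, hv⟩ := h
    exact ih (exists_edistFrom_eq_of_succ hv)

theorem lt_card_of_edistFrom_eq {V : Type*} [Fintype V] {X : V → V → Prop} {S : Finset V}
    {n : ℕ} {v : V} (h : edistFrom X S v = n) : n < Fintype.card V := by
  have hex (m : Fin (n + 1)) : ∃ w, edistFrom X S w = (m : ℕ) :=
    exists_edistFrom_eq_of_le (Nat.le_of_lt_succ m.2) ⟨v, h⟩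
  choose f hf using hex
  have hinj : Function.Injective f := fun a b hab => by
    have hcast : ((a : ℕ) : ℕ∞) = (b : ℕ) := by rw [← hf a, ← hf b, hab]
    exact Fin.ext (by exact_mod_cast hcast)
  simpa using Fintype.card_le_of_injective f hinj

/-- Truncating distances at `D ≥ |V|` loses no information. -/
theorem edistFrom_eq_of_min_eq {V : Type*} [Fintype V] {X Y : V → V → Prop} {S : Finset V}
    {D : ℕ} (hD : Fintype.card V ≤ D) {v : V}
    (h : min (edistFrom X S v) (D : ℕ∞) = min (edistFrom Y S v) (D : ℕ∞)) :
    edistFrom X S v = edistFrom Y S v := by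
  have key (Z : V → V → Prop) : edistFrom Z S v = ⊤ ∨ edistFrom Z S v < D := by
    refine or_iff_not_imp_left.2 fun hZ => ?_
    obtain ⟨n, hn⟩ := ENat.ne_top_iff_exists.1 hZ
    rw [← hn]
    exact_mod_cast (lt_card_of_edistFrom_eq hn.symm).trans_le hD
  rcases key X with hX | hX <;> rcases key Y with hY | hY
  · rw [hX, hY]
  · rw [hX, min_eq_right le_top, min_eq_left hY.le] at h
    exact absurd h hY.ne'
  · rw [hY, min_eq_right le_top, min_eq_left hX.le] at h
    exact absurd h hX.ne
  · rwa [min_eq_left hX.le, min_eq_left hY.le] at h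

theorem obsPartition_le {V : Type*} [Fintype V] {ι : Type*} [Fintype ι] [DecidableEq ι]
    (X : ι → V → V → Prop) (S₁ : Finset V) {D : ℕ} (hD : Fintype.card V ≤ D) (d : ℕ) :
    obsPartition X S₁ D ≤ obsPartition X S₁ d := by
  classical
  intro A hA
  obtain ⟨a, ha⟩ := (obsPartition X S₁ D).nonempty_of_mem_parts hA
  refine ⟨(obsPartition X S₁ d).part a,
    (obsPartition X S₁ d).part_mem.2 (Finset.mem_univ a), fun b hb => ?_⟩
  rw [← (obsPartition X S₁ D).part_eq_of_mem hA ha] at hb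
  unfold obsPartition at hb ⊢
  rw [Finpartition.mem_part_ofSetoid_iff_rel, Setoid.ker_def] at hb ⊢
  funext v
  exact congrArg (min · (d : ℕ∞)) (edistFrom_eq_of_min_eq hD (congrFun hb v))

/-- Refining the observation partition cannot decrease the two-phase objective. -/
theorem twoPhase_le_of_le {V : Type*} [Fintype V] [DecidableEq V]
    {ι : Type*} [Fintype ι] [DecidableEq ι] (X : ι → V → V → Prop) (p : ι → ℝ) (k₂ : ℕ)
    {P Q : Finpartition (Finset.univ : Finset ι)} (hPQ : P ≤ Q) (S₁ : Finset V) :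
    twoPhase X p k₂ Q S₁ ≤ twoPhase X p k₂ P S₁ := by
  have sum_parts (R : Finpartition (Finset.univ : Finset ι)) (g : ι → ℝ) :
      ∑ B ∈ R.parts, ∑ i ∈ B, g i = ∑ i, g i := by
    refine (Finset.sum_biUnion (t := id) R.disjoint).symm.trans ?_
    rw [R.biUnion_parts]
  have hopt (B : Finset ι) := Finset.exists_mem_eq_sup' (candidates_nonempty V k₂)
    fun S₂ => ∑ i ∈ B, p i * sigma' (X i) (S₁ ∪ S₂)
  choose T hT hsup using hopt
  calc twoPhase X p k₂ Q S₁
      = ∑ B ∈ Q.parts, ∑ i ∈ B, p i * sigma' (X i) (S₁ ∪ T (Q.part i)) := by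
        refine Finset.sum_congr rfl fun B hB => (hsup B).trans ?_
        exact Finset.sum_congr rfl fun i hi => by rw [Q.part_eq_of_mem hB hi]
    _ = ∑ A ∈ P.parts, ∑ i ∈ A, p i * sigma' (X i) (S₁ ∪ T (Q.part i)) := by
        rw [sum_parts, sum_parts]
    _ ≤ twoPhase X p k₂ P S₁ := by
        refine Finset.sum_le_sum fun A hA => ?_
        obtain ⟨B, hB, hAB⟩ := hPQ hA
        rw [Finset.sum_congr rfl fun i hi => by rw [Q.part_eq_of_mem hB (hAB hi)]]
        exact Finset.le_sup' (fun S₂ => ∑ i ∈ A, p i * sigma' (X i) (S₁ ∪ S₂)) (hT B)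

/-- The two-phase objective is maximized by waiting until the first-phase diffusion is
complete: for every `D ≥ |V|` and every delay `d`,
`F_{Obs(S₁,d)}(S₁) ≤ F_{Obs(S₁,D)}(S₁)`. -/
theorem twoPhase_obs_max_at_completion {V : Type*} [Fintype V] [DecidableEq V]
    {ι : Type*} [Fintype ι] [DecidableEq ι]
    (X : ι → V → V → Prop) (p : ι → ℝ)
    (hp : ∀ i, 0 ≤ p i) (hp1 : ∑ i, p i = 1) :
    ∀ (S₁ : Finset V) (k₂ : ℕ) (D : ℕ), Fintype.card V ≤ D →
      ∀ d : ℕ,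
        twoPhase X p k₂ (obsPartition X S₁ d) S₁ ≤
          twoPhase X p k₂ (obsPartition X S₁ D) S₁ := by
  intro S₁ k₂ D hD d
  exact twoPhase_le_of_le X p k₂ (obsPartition_le X S₁ hD d) S₁
end

section
/- The time-discounted expected influence is nonnegative, monotone increasing, and submodular: let Γ : ℕ∞ → ℝ be an antitone function with 0 ≤ Γ(t) ≤ 1 for all t; then the set function ν(S) := Σ_{j ∈ V} Σ_{X ∈ 𝒳} p(X) · Γ(dist_X(S, j)) is nonnegative, monotone increasing, and submodular on subsets of V. -/
/-- The time-discounted expected influence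
`ν(S) = Σ_{j ∈ V} Σ_{X ∈ 𝒳} p(X) · Γ(dist_X(S, j))`. -/
noncomputable def timeDiscountedSpread {V : Type*} [Fintype V]
    {ι : Type*} [Fintype ι] (X : ι → V → V → Prop) (p : ι → ℝ) (Γ : ℕ∞ → ℝ)
    (S : Finset V) : ℝ :=
  ∑ j : V, ∑ i : ι, p i * Γ (edistFrom (X i) S j)

theorem edistFrom_union {V : Type*} [DecidableEq V] (X : V → V → Prop) (S T : Finset V) (v : V) :
    edistFrom X (S ∪ T) v = edistFrom X S v ⊓ edistFrom X T v := by
  simp only [edistFrom, Finset.mem_union, or_and_right, exists_or, iInf_or, iInf_inf_eq]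

theorem edistFrom_anti {V : Type*} (X : V → V → Prop) (v : V) :
    Antitone fun S : Finset V => edistFrom X S v := fun _ _ h =>
  iInf_mono fun _ => iInf_mono' fun ⟨u, hu, hr⟩ => ⟨⟨u, h hu, hr⟩, le_rfl⟩

/-- The time-discounted expected influence is nonnegative, monotone increasing, and
submodular, for any antitone discount function `Γ : ℕ∞ → ℝ` with `0 ≤ Γ(t) ≤ 1`. -/
theorem timeDiscountedSpread_nonneg_monotone_submodular
    {V : Type*} [Fintype V] [DecidableEq V]
    {ι : Type*} [Fintype ι] (X : ι → V → V → Prop) (p : ι → ℝ)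
    (hp : ∀ i, 0 ≤ p i) (hp1 : ∑ i, p i = 1)
    (Γ : ℕ∞ → ℝ) (hΓ : Antitone Γ) (hΓ0 : ∀ t, 0 ≤ Γ t) (hΓ1 : ∀ t, Γ t ≤ 1) :
    (∀ S : Finset V, 0 ≤ timeDiscountedSpread X p Γ S) ∧
    (∀ S T : Finset V, S ⊆ T →
      timeDiscountedSpread X p Γ S ≤ timeDiscountedSpread X p Γ T) ∧
    (∀ S T : Finset V, S ⊆ T → ∀ i ∉ T,
      timeDiscountedSpread X p Γ (T ∪ {i}) - timeDiscountedSpread X p Γ T ≤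
        timeDiscountedSpread X p Γ (S ∪ {i}) - timeDiscountedSpread X p Γ S) := by
  have key {S T : Finset V} (hST : S ⊆ T) (i : ι) (j : V) :
      Γ (edistFrom (X i) S j) ≤ Γ (edistFrom (X i) T j) :=
    hΓ (edistFrom_anti (X i) j hST)
  refine ⟨fun S => ?_, fun S T hST => ?_, fun S T hST v _ => ?_⟩
  · exact Finset.sum_nonneg fun j _ => Finset.sum_nonneg fun i _ => mul_nonneg (hp i) (hΓ0 _)
  · exact Finset.sum_le_sum fun j _ => Finset.sum_le_sum fun i _ =>
      mul_le_mul_of_nonneg_left (key hST i j) (hp i)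
  · simp only [timeDiscountedSpread, ← Finset.sum_sub_distrib, ← mul_sub]
    refine Finset.sum_le_sum fun j _ => Finset.sum_le_sum fun i _ =>
      mul_le_mul_of_nonneg_left ?_ (hp i)
    rw [edistFrom_union, edistFrom_union, hΓ.map_inf, hΓ.map_inf]
    have := key hST i j
    grind
end

section
/- Two-phase reachability decomposition: fix a live graph X on a finite node set V, sets S₁, S₂ ⊆ V, and d ∈ ℕ. Let A = {v ∈ V : dist_X(S₁, v) < d} (the already activated nodes) and R = {v ∈ V : dist_X(S₁, v) = d} (the recently activated nodes). Then the set of nodes reachable from S₁ ∪ S₂ in X is the disjoint union of A and the set of nodes reachable from R ∪ (S₂ \ A) in the subgraph of X induced on V \ A; in particular, σ^X(S₁ ∪ S₂) = |A| + σ^{X \ A}(R ∪ (S₂ \ A)), where σ^{X \ A} denotes the number of reachable nodes computed in the induced subgraph on V \ A. -/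
/-- The set of nodes reachable from the seed set `S` in the live graph `X`
(reflexive-transitive closure of the edge relation). -/
def reachSet {V : Type*} (X : V → V → Prop) (S : Set V) : Set V :=
  {v | ∃ u ∈ S, Relation.ReflTransGen X u v}

theorem reachIn_trans_edge {V : Type*} {X : V → V → Prop} {n : ℕ} {u v w : V}
    (h : reachIn X n u v) (hvw : X v w) : reachIn X (n + 1) u w := by
  induction n generalizing u with
  | zero =>
    obtain rfl : u = v := h
    exact ⟨w, hvw, rfl⟩
  | succ n ih =>
    obtain ⟨x, hux, hxv⟩ := h
    exact ⟨x, hux, ih hxv⟩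

theorem reachIn_reflTransGen {V : Type*} {X : V → V → Prop} {n : ℕ} {u v : V}
    (h : reachIn X n u v) : Relation.ReflTransGen X u v := by
  induction n generalizing u with
  | zero =>
    obtain rfl : u = v := h
    exact .refl
  | succ n ih =>
    obtain ⟨x, hux, hxv⟩ := h
    exact .head hux (ih hxv)

theorem exists_reachIn_of_edistFrom_lt {V : Type*} {X : V → V → Prop} {S : Finset V} {v : V}
    {a : ℕ∞} (h : edistFrom X S v < a) : ∃ n : ℕ, (n : ℕ∞) < a ∧ ∃ u ∈ S, reachIn X n u v := by
  simp only [edistFrom, iInf_lt_iff] at h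
  obtain ⟨n, hn, hlt⟩ := h
  exact ⟨n, hlt, hn⟩

theorem mem_reachSet_of_edistFrom_lt {V : Type*} {X : V → V → Prop} {S : Finset V} {v : V}
    {a : ℕ∞} (h : edistFrom X S v < a) : v ∈ reachSet X (S : Set V) := by
  obtain ⟨n, -, u, hu, huv⟩ := exists_reachIn_of_edistFrom_lt h
  exact ⟨u, hu, reachIn_reflTransGen huv⟩

theorem edistFrom_le_of_edge {V : Type*} {X : V → V → Prop} {S : Finset V} {v w : V} {d : ℕ}
    (h : edistFrom X S v < d) (hvw : X v w) : edistFrom X S w ≤ d := by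
  obtain ⟨n, hn, u, hu, huv⟩ := exists_reachIn_of_edistFrom_lt h
  have hnd : n < d := by exact_mod_cast hn
  exact (edistFrom_le hu (reachIn_trans_edge huv hvw)).trans (by exact_mod_cast hnd)

theorem reachSet_mono {V : Type*} {X : V → V → Prop} {S T : Set V} (h : S ⊆ T) :
    reachSet X S ⊆ reachSet X T :=
  fun _ ⟨u, hu, huv⟩ => ⟨u, h hu, huv⟩

/-- Two-phase reachability decomposition: with `A` the set of already activated nodes
(`dist_X(S₁, ·) < d`), `R` the set of recently activated nodes (`dist_X(S₁, ·) = d`),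
and `X'` the subgraph of `X` induced on `V \ A`, the set of nodes reachable from
`S₁ ∪ S₂` in `X` is the disjoint union of `A` and the set of nodes reachable from
`R ∪ (S₂ \ A)` in `X'`; in particular
`σ^X(S₁ ∪ S₂) = |A| + σ^{X \ A}(R ∪ (S₂ \ A))`. -/
theorem twoPhase_reachability_decomposition {V : Type*} [Fintype V] [DecidableEq V]
    (X : V → V → Prop) (S₁ S₂ : Finset V) (d : ℕ)
    (A R : Set V)
    (hA : A = {v | edistFrom X S₁ v < (d : ℕ∞)})
    (hR : R = {v | edistFrom X S₁ v = (d : ℕ∞)})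
    (X' : V → V → Prop)
    (hX' : ∀ u v, X' u v ↔ X u v ∧ u ∉ A ∧ v ∉ A) :
    reachSet X (↑(S₁ ∪ S₂)) = A ∪ reachSet X' (R ∪ (↑S₂ \ A)) ∧
    Disjoint A (reachSet X' (R ∪ (↑S₂ \ A))) ∧
    (reachSet X (↑(S₁ ∪ S₂))).ncard =
      A.ncard + (reachSet X' (R ∪ (↑S₂ \ A))).ncard := by
  have hdisj : Disjoint A (reachSet X' (R ∪ (↑S₂ \ A))) := by
    rw [Set.disjoint_right]
    rintro v ⟨u, hu, huv⟩
    rcases Relation.ReflTransGen.cases_tail huv with rfl | ⟨w, -, hwv⟩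
    · rcases hu with hu | hu
      · subst hA hR
        exact fun h => (ne_of_lt h) hu
      · exact hu.2
    · exact ((hX' _ _).1 hwv).2.2
  have hle : ∀ v, edistFrom X S₁ v ≤ d → v ∈ A ∪ reachSet X' (R ∪ (↑S₂ \ A)) := by
    intro v hv
    rcases hv.lt_or_eq with h | h
    · exact Or.inl (hA ▸ h)
    · exact Or.inr ⟨v, Or.inl (hR ▸ h), .refl⟩
  have heq : reachSet X (↑(S₁ ∪ S₂)) = A ∪ reachSet X' (R ∪ (↑S₂ \ A)) := by
    apply Set.Subset.antisymm
    · rintro v ⟨u, hu, huv⟩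
      induction huv with
      | refl =>
        rcases Finset.mem_union.1 (Finset.mem_coe.1 hu) with hu | hu
        · exact hle u ((edistFrom_le (n := 0) hu rfl).trans (by simp))
        · by_cases huA : u ∈ A
          · exact Or.inl huA
          · exact Or.inr ⟨u, Or.inr ⟨hu, huA⟩, .refl⟩
      | @tail b c _ hbc ih =>
        rcases ih with hb | hb
        · rw [hA] at hb
          exact hle c (edistFrom_le_of_edge hb hbc)
        · by_cases hc : c ∈ A
          · exact Or.inl hc
          · have hbA := Set.disjoint_right.1 hdisj hb
            obtain ⟨s, hs, hsb⟩ := hb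
            exact Or.inr ⟨s, hs, hsb.tail ((hX' _ _).2 ⟨hbc, hbA, hc⟩)⟩
    · have hS₁ : reachSet X (S₁ : Set V) ⊆ reachSet X (↑(S₁ ∪ S₂)) :=
        reachSet_mono (by simp)
      rintro v (hv | ⟨u, hu, huv⟩)
      · rw [hA] at hv
        exact hS₁ (mem_reachSet_of_edistFrom_lt hv)
      · have huX : u ∈ reachSet X (↑(S₁ ∪ S₂)) := by
          rcases hu with hu | hu
          · rw [hR] at hu
            have hlt : edistFrom X S₁ u < ⊤ := lt_of_eq_of_lt hu (ENat.natCast_lt_top d)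
            exact hS₁ (mem_reachSet_of_edistFrom_lt hlt)
          · exact ⟨u, by simpa using Or.inr hu.1, .refl⟩
        obtain ⟨s, hs, hsu⟩ := huX
        exact ⟨s, hs, hsu.trans (Relation.ReflTransGen.mono (fun a b h => ((hX' a b).1 h).1) _ _ huv)⟩
  exact ⟨heq, hdisj, heq ▸ Set.ncard_union_eq hdisj⟩
end
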